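/- arXiv:1502.05771 — 7 statements merged into one kernel-verified Lean document; each statement's English description precedes it below -/
import Mathlib

section
/- Let R be a commutative ring, let n ≥ 1, and let A be an n×n matrix over R with zero diagonal (the weighted adjacency matrix of a finite directed graph with no self-loops). Then det(I − z·A) = ∑_{k=0}^{n} c_k z^k, where c_0 = 1 and, for each k ≥ 1, c_k equals the sum over all k-element subsets S of the index set and over all fixed-point-free permutations σ of S (equivalently, over all families of pairwise vertex-disjoint simple cycles of total length k) of (−1)^{c(σ)} · ∏_{i∈S} A_{i,σ(i)}, where c(σ) is the number of cycles of σ; that is, each simple cycle contributes a factor equal to minus the product of the adjacency entries along that cycle. -/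
open Finset Equiv in
/-- The contribution of a permutation `σ` to the Leibniz expansion of `det (1 - z • A)`. -/
theorem sign_mul_prod_one_sub_smul {R ι : Type*} [CommRing R] [Fintype ι] [DecidableEq ι]
    (A : Matrix ι ι R) (hdiag : ∀ i, A i i = 0) (z : R) (σ : Perm ι) :
    ((Perm.sign σ : ℤ) : R) * ∏ i, ((1 : Matrix ι ι R) - z • A) i (σ i) =
      (-1 : R) ^ (Multiset.card σ.cycleType) * (∏ i ∈ σ.support, A i (σ i)) *
        z ^ #σ.support := by
  have hprod : ∏ i, ((1 : Matrix ι ι R) - z • A) i (σ i) =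
      ∏ i ∈ σ.support, (-z) * A i (σ i) := by
    rw [← prod_subset (subset_univ σ.support)]
    · refine prod_congr rfl fun i hi => ?_
      simp [Matrix.one_apply_ne (Perm.mem_support.mp hi).symm]
    · intro i _ hi
      simp [Perm.notMem_support.mp hi, hdiag]
  have hsq : (-1 : R) ^ #σ.support * (-1) ^ #σ.support = 1 := by
    rw [← mul_pow]; simp
  rw [hprod, prod_mul_distrib, prod_const, neg_pow z, Perm.sign_of_cycleType,
    Perm.sum_cycleType, pow_add]
  push_cast
  linear_combination ((-1 : R) ^ (Multiset.card σ.cycleType) *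
    (∏ i ∈ σ.support, A i (σ i)) * z ^ #σ.support) * hsq

open Finset Equiv in
/-- Summing over the permutations with support `S`, for all `S` of size `k`, is summing over the
permutations with support of size `k`. -/
theorem sum_powersetCard_sum_support_eq {R ι : Type*} [AddCommMonoid R] [Fintype ι]
    [DecidableEq ι] (k : ℕ) (f : Finset ι → Perm ι → R) :
    ∑ S ∈ powersetCard k (univ : Finset ι), ∑ σ : Perm ι with σ.support = S, f S σ =
      ∑ σ : Perm ι with #σ.support = k, f σ.support σ := by
  rw [← sum_fiberwise_of_maps_to (g := Perm.support) (t := powersetCard k univ)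
    (by simp [mem_powersetCard])]
  refine sum_congr rfl fun S hS => ?_
  rw [filter_filter]
  refine sum_congr ?_ ?_
  · ext σ
    simp only [mem_powersetCard] at hS
    simp only [mem_filter, mem_univ, true_and]
    exact ⟨fun h => ⟨h ▸ hS.2, h⟩, fun h => h.2⟩
  · intro σ hσ
    rw [(mem_filter.mp hσ).2.2]

/-- For an `n × n` matrix `A` over a commutative ring with zero diagonal (the weighted
adjacency matrix of a finite directed graph with no self-loops), the reciprocal Ihara
zeta function `det (I - z • A)` is a polynomial `∑_{k=0}^n c_k z^k` in `z`, where
`c_0 = 1` and for `k ≥ 1` the coefficient `c_k` is the sum over all `k`-element subsets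
`S` of the vertices and all fixed-point-free permutations `σ` of `S` (i.e. permutations
with support exactly `S`, equivalently families of pairwise vertex-disjoint simple
cycles of total length `k`) of `(-1)^{c(σ)} ∏_{i ∈ S} A i (σ i)`, with `c(σ)` the
number of cycles of `σ`. -/
theorem ihara_reciprocal_coeff_simple_cycles {R : Type*} [CommRing R] {n : ℕ}
    (hn : 1 ≤ n) (A : Matrix (Fin n) (Fin n) R) (hdiag : ∀ i, A i i = 0) (z : R) :
    ((1 : Matrix (Fin n) (Fin n) R) - z • A).det =
      ∑ k ∈ Finset.range (n + 1),
        (if k = 0 then 1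
          else
            ∑ S ∈ Finset.powersetCard k (Finset.univ : Finset (Fin n)),
              ∑ σ ∈ Finset.univ.filter (fun σ : Equiv.Perm (Fin n) => σ.support = S),
                (-1 : R) ^ (Multiset.card σ.cycleType) * ∏ i ∈ S, A i (σ i)) * z ^ k := by
  have hdet : ((1 : Matrix (Fin n) (Fin n) R) - z • A).det =
      ∑ σ : Equiv.Perm (Fin n), (-1 : R) ^ (Multiset.card σ.cycleType) *
        (∏ i ∈ σ.support, A i (σ i)) * z ^ σ.support.card := by
    rw [← Matrix.det_transpose, Matrix.det_apply']
    exact Finset.sum_congr rfl fun σ _ => sign_mul_prod_one_sub_smul A hdiag z σ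
  rw [hdet, ← Finset.sum_fiberwise_of_maps_to (g := fun σ : Equiv.Perm (Fin n) => σ.support.card)
    (t := Finset.range (n + 1))
    (fun σ _ => Finset.mem_range_succ_iff.mpr (σ.support.card_le_univ.trans_eq (by simp)))]
  refine Finset.sum_congr rfl fun k _ => ?_
  rw [sum_powersetCard_sum_support_eq]
  split_ifs with hk
  · subst hk
    simp [Finset.filter_eq']
  · rw [Finset.sum_mul]
    refine Finset.sum_congr rfl fun σ hσ => ?_
    rw [(Finset.mem_filter.mp hσ).2]
end

section
/- Let R be a commutative ring, let n ≥ 1, and let A be an n×n matrix over R with zero diagonal. Assume that for every pair of vertex-disjoint simple cycles (i.e., fixed-point-free cyclic permutations σ₁ on S₁ and σ₂ on S₂ with S₁ ∩ S₂ = ∅), the weight ∏_{i∈S₁} A_{i,σ₁(i)} or the weight ∏_{i∈S₂} A_{i,σ₂(i)} is zero (any two simple cycles of the graph share a vertex). Then for every k ≥ 1, the coefficient of z^k in det(I − z·A) equals the negative of the sum, over all cyclic fixed-point-free permutations σ of k-element subsets S, of ∏_{i∈S} A_{i,σ(i)} (i.e., minus the total weight of simple cycles of length k). -/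
open Polynomial in
/-- Vertices fixed by `σ` contribute `1` and moved vertices contribute `-X * A i (σ i)`. -/
theorem Matrix.prod_one_sub_X_smul_apply_perm {R ι : Type*} [CommRing R] [Fintype ι]
    [DecidableEq ι] (A : Matrix ι ι R) (hdiag : ∀ i, A i i = 0) (σ : Equiv.Perm ι) :
    ∏ i, ((1 : Matrix ι ι R[X]) - (X : R[X]) • A.map C) i (σ i) =
      C ((-1) ^ σ.support.card * ∏ i ∈ σ.support, A i (σ i)) * X ^ σ.support.card := by
  have hfixed : ∏ i ∈ σ.support, ((1 : Matrix ι ι R[X]) - (X : R[X]) • A.map C) i (σ i) =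
      ∏ i, ((1 : Matrix ι ι R[X]) - (X : R[X]) • A.map C) i (σ i) := by
    refine Finset.prod_subset (Finset.subset_univ _) fun i _ hi => ?_
    simp [Equiv.Perm.notMem_support.mp hi, hdiag]
  have hmoved : ∀ i ∈ σ.support, ((1 : Matrix ι ι R[X]) - (X : R[X]) • A.map C) i (σ i) =
      C (-1) * X * C (A i (σ i)) := by
    intro i hi
    simp [Matrix.one_apply_ne (Equiv.Perm.mem_support.mp hi).symm]
  rw [← hfixed, Finset.prod_congr rfl hmoved, Finset.prod_mul_distrib, Finset.prod_const,
    mul_pow, C_mul, C_pow, map_prod]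
  ring

/-- A permutation which is neither the identity nor a cycle has two distinct cycle factors. -/
theorem Equiv.Perm.exists_ne_mem_cycleFactorsFinset {ι : Type*} [Fintype ι] [DecidableEq ι]
    {σ : Equiv.Perm ι} (hone : σ ≠ 1) (hcycle : ¬ σ.IsCycle) :
    ∃ c ∈ σ.cycleFactorsFinset, ∃ d ∈ σ.cycleFactorsFinset, c ≠ d := by
  rw [← Finset.one_lt_card]
  have h0 : σ.cycleFactorsFinset.card ≠ 0 := by
    simpa [Equiv.Perm.cycleFactorsFinset_eq_empty_iff] using hone
  have h1 : σ.cycleFactorsFinset.card ≠ 1 := by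
    rw [← Equiv.Perm.card_cycleType_eq_one] at hcycle
    simpa [Equiv.Perm.cycleType_def] using hcycle
  omega

/-- The weight of a cycle factor divides the weight of the permutation. -/
theorem Equiv.Perm.prod_support_dvd_of_mem_cycleFactorsFinset {R ι : Type*} [CommMonoid R]
    [Fintype ι] [DecidableEq ι] (A : Matrix ι ι R) {σ c : Equiv.Perm ι}
    (hc : c ∈ σ.cycleFactorsFinset) :
    ∏ i ∈ c.support, A i (c i) ∣ ∏ i ∈ σ.support, A i (σ i) := by
  rw [Finset.prod_congr rfl fun i hi => by
    rw [(Equiv.Perm.mem_cycleFactorsFinset_iff.mp hc).2 i hi]]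
  exact Finset.prod_dvd_prod_of_subset _ _ _
    (Equiv.Perm.mem_cycleFactorsFinset_support_le hc)


open scoped Classical in

/-- Let `A` be the (weighted) adjacency matrix of a directed graph with no self-loops,
over a commutative ring. Assume that for every pair of vertex-disjoint simple cycles
(fixed-point-free cyclic permutations `σ₁`, `σ₂` with disjoint supports) the weight of
`σ₁` or the weight of `σ₂` vanishes (any two simple cycles share a vertex). Then for
every `k ≥ 1` the coefficient of `z^k` in `det (I - z • A)` is the negative of the sum,
over all cyclic fixed-point-free permutations `σ` of `k`-element subsets of the
vertices, of the weights `∏_{i ∈ supp σ} A i (σ i)`, i.e. minus the total weight of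
simple cycles of length `k`. -/
theorem ihara_reciprocal_coeff_of_no_disjoint_cycles {R : Type*} [CommRing R] {n : ℕ}
    (hn : 1 ≤ n) (A : Matrix (Fin n) (Fin n) R) (hdiag : ∀ i, A i i = 0)
    (hshare : ∀ σ₁ σ₂ : Equiv.Perm (Fin n), σ₁.IsCycle → σ₂.IsCycle →
      Disjoint σ₁.support σ₂.support →
      (∏ i ∈ σ₁.support, A i (σ₁ i)) = 0 ∨ (∏ i ∈ σ₂.support, A i (σ₂ i)) = 0)
    (k : ℕ) (hk : 1 ≤ k) :
    (((1 : Matrix (Fin n) (Fin n) (Polynomial R)) -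
        (Polynomial.X : Polynomial R) • A.map Polynomial.C).det).coeff k =
      - ∑ σ ∈ Finset.univ.filter
          (fun σ : Equiv.Perm (Fin n) => σ.IsCycle ∧ σ.support.card = k),
          ∏ i ∈ σ.support, A i (σ i) := by
  rw [← Matrix.det_transpose, Matrix.det_apply, Polynomial.finsetSum_coeff, Finset.sum_filter,
    ← Finset.sum_neg_distrib]
  refine Finset.sum_congr rfl fun σ _ => ?_
  simp only [Matrix.transpose_apply]
  rw [Matrix.prod_one_sub_X_smul_apply_perm A hdiag, Units.smul_def, Polynomial.coeff_smul,
    Polynomial.coeff_C_mul_X_pow]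
  by_cases hcycle : σ.IsCycle
  · by_cases hcard : σ.support.card = k
    · rw [if_pos hcard.symm, if_pos ⟨hcycle, hcard⟩, hcycle.sign, hcard]
      have hsq : ((-1 : R) ^ k) * (-1) ^ k = 1 := by rw [← mul_pow]; simp
      simp [zsmul_eq_mul, ← mul_assoc, hsq]
    · rw [if_neg (Ne.symm hcard), if_neg fun h => hcard h.2]
      simp
  · rw [if_neg (c := σ.IsCycle ∧ _) fun h => hcycle h.1, neg_zero]
    by_cases hone : σ = 1
    · rw [if_neg (by simp [hone]; omega), smul_zero]
    · obtain ⟨c, hc, d, hd, hcd⟩ := Equiv.Perm.exists_ne_mem_cycleFactorsFinset hone hcycle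
      have hdisj : Disjoint c.support d.support :=
        (σ.cycleFactorsFinset_pairwise_disjoint hc hd hcd).disjoint_support
      have hweight : ∏ i ∈ σ.support, A i (σ i) = 0 := by
        rcases hshare c d (Equiv.Perm.mem_cycleFactorsFinset_iff.mp hc).1
          (Equiv.Perm.mem_cycleFactorsFinset_iff.mp hd).1 hdisj with h | h
        · exact zero_dvd_iff.mp
            (h ▸ Equiv.Perm.prod_support_dvd_of_mem_cycleFactorsFinset A hc)
        · exact zero_dvd_iff.mp
            (h ▸ Equiv.Perm.prod_support_dvd_of_mem_cycleFactorsFinset A hd)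
      simp [hweight]
end

section
/- If positive integers a < b < c satisfy a² + b² + c² = a·b·c, then c·(ab − c) = a² + b²; consequently ab − c is a positive integer with 0 < ab − c < b, so (a, b, ab − c) is again a positive solution of the equation whose maximal entry is strictly smaller than c. -/
/-- If positive integers `a < b < c` satisfy the Markov-type equation
`a² + b² + c² = a b c`, then `c (ab - c) = a² + b²`; consequently `0 < ab - c < b`, so
`(a, b, ab - c)` is again a positive solution whose maximal entry is strictly smaller
than `c`. -/
theorem markov_descending_step (a b c : ℤ) (ha : 0 < a) (hab : a < b) (hbc : b < c)
    (h : a ^ 2 + b ^ 2 + c ^ 2 = a * b * c) :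
    c * (a * b - c) = a ^ 2 + b ^ 2 ∧
    0 < a * b - c ∧ a * b - c < b ∧
    a ^ 2 + b ^ 2 + (a * b - c) ^ 2 = a * b * (a * b - c) := by
  have prod : c * (a * b - c) = a ^ 2 + b ^ 2 := by linarith
  have ha3 : 3 ≤ a := by
    by_contra! ha3
    have hbc0 : 0 < b * c := mul_pos (ha.trans hab) (ha.trans (hab.trans hbc))
    nlinarith [sq_nonneg (b - c), mul_nonneg (by linarith : 0 ≤ 2 - a) hbc0.le]
  have hsq : a ^ 2 < b ^ 2 := by nlinarith
  have hneg : a ^ 2 + 2 * b ^ 2 < a * b ^ 2 := by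
    nlinarith [mul_nonneg (by linarith : 0 ≤ a - 3) (sq_nonneg b)]
  have hfactor : 0 < (c - b) * (b - (a * b - c)) := by linarith
  refine ⟨prod, ?_, ?_, by linarith⟩
  · exact pos_of_mul_pos_right (by rw [prod]; positivity) (ha.trans (hab.trans hbc)).le
  · exact sub_pos.mp (pos_of_mul_pos_right hfactor (sub_pos.mpr hbc).le)
end

section
/- Every triple (u, v, w) of positive integers satisfying u² + v² + w² = u·v·w can be obtained from the basic solution (3, 3, 3) by finitely many applications of the three Seiberg transformations (u,v,w) ↦ (vw − u, v, w), (u,v,w) ↦ (u, uw − v, w), and (u,v,w) ↦ (u, v, uv − w). Formally, (u, v, w) lies in the reflexive-transitive closure of the relation generated by these three maps, started at (3, 3, 3). -/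
/-- One step of Seiberg transformation on a triple `(u, v, w)`: replace one component
by the product of the other two minus itself, i.e. pass to `(vw - u, v, w)`,
`(u, uw - v, w)` or `(u, v, uv - w)`. -/
def SeibergStep (p q : ℤ × ℤ × ℤ) : Prop :=
  q = (p.2.1 * p.2.2 - p.1, p.2.1, p.2.2) ∨
  q = (p.1, p.1 * p.2.2 - p.2.1, p.2.2) ∨
  q = (p.1, p.2.1, p.1 * p.2.1 - p.2.2)

theorem SeibergStep.fst (u v w : ℤ) : SeibergStep (v * w - u, v, w) (u, v, w) := by
  simp [SeibergStep]

theorem SeibergStep.snd (u v w : ℤ) : SeibergStep (u, u * w - v, w) (u, v, w) := by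
  simp [SeibergStep]

theorem SeibergStep.trd (u v w : ℤ) : SeibergStep (u, v, u * v - w) (u, v, w) := by
  simp [SeibergStep]

/-- An ordered positive solution whose largest entry cannot be decreased is `(3, 3, 3)`. -/
theorem markov_minimal_of_le {u v w : ℤ} (hu : 0 < u) (huv : u ≤ v) (hvw : v ≤ w)
    (h : u ^ 2 + v ^ 2 + w ^ 2 = u * v * w) (hmin : 2 * w ≤ u * v) :
    u = 3 ∧ v = 3 ∧ w = 3 := by
  have hroot : 0 ≤ (w - v) * (u * v - w - v) :=
    mul_nonneg (by linarith) (by linarith)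
  have hbound : (u - 2) * v ^ 2 ≤ u ^ 2 := by nlinarith
  have hu3 : u ≤ 3 := by
    by_contra! hlt
    nlinarith [mul_nonneg (show 0 ≤ u - 4 by linarith) (sq_nonneg v)]
  interval_cases u
  · nlinarith
  · nlinarith [sq_nonneg (v - w)]
  · have hv : v = 3 := by nlinarith
    subst hv
    refine ⟨rfl, rfl, ?_⟩
    nlinarith

/-- A positive solution whose largest entry cannot be decreased is `(3, 3, 3)`. -/
theorem markov_minimal {u v w : ℤ} (hu : 0 < u) (hv : 0 < v) (huw : u ≤ w) (hvw : v ≤ w)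
    (h : u ^ 2 + v ^ 2 + w ^ 2 = u * v * w) (hmin : 2 * w ≤ u * v) :
    u = 3 ∧ v = 3 ∧ w = 3 := by
  rcases le_total u v with huv | hvu
  · exact markov_minimal_of_le hu huv hvw h hmin
  · obtain ⟨h₁, h₂, h₃⟩ :=
      markov_minimal_of_le hv hvu huw (by linarith) (by linarith)
    exact ⟨h₂, h₁, h₃⟩

/-- The Vieta-conjugate of a positive entry of a solution is positive. -/
theorem markov_conjugate_pos {u v w : ℤ} (hu : 0 < u) (hw : 0 < w)
    (h : u ^ 2 + v ^ 2 + w ^ 2 = u * v * w) : 0 < u * v - w := by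
  have hprod : 0 < w * (u * v - w) := by nlinarith [sq_nonneg v, pow_pos hu 2]
  exact pos_of_mul_pos_right hprod hw.le

/-- Every triple of positive integers satisfying the Markov-type equation
`u² + v² + w² = u v w` can be obtained from the basic solution `(3, 3, 3)` by finitely
many Seiberg transformations: it lies in the reflexive-transitive closure of the
relation generated by the three Seiberg maps, started at `(3, 3, 3)`. -/
theorem markov_solutions_generated_from_basic (u v w : ℤ)
    (hu : 0 < u) (hv : 0 < v) (hw : 0 < w)
    (h : u ^ 2 + v ^ 2 + w ^ 2 = u * v * w) :
    Relation.ReflTransGen SeibergStep (3, 3, 3) (u, v, w) := by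
  induction hn : (u + v + w).toNat using Nat.strong_induction_on generalizing u v w with
  | _ n ih =>
    have hmax : (u ≤ w ∧ v ≤ w) ∨ (u ≤ v ∧ w ≤ v) ∨ (v ≤ u ∧ w ≤ u) := by omega
    rcases hmax with ⟨h₁, h₂⟩ | ⟨h₁, h₂⟩ | ⟨h₁, h₂⟩
    · rcases le_or_gt (2 * w) (u * v) with hmin | hlt
      · obtain ⟨rfl, rfl, rfl⟩ := markov_minimal hu hv h₁ h₂ h hmin
        exact .refl
      · have hpos := markov_conjugate_pos hu hw h
        exact (ih _ (by omega) u v (u * v - w) hu hv hpos (by linarith) rfl).tail (.trd u v w)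
    · have h' : u ^ 2 + w ^ 2 + v ^ 2 = u * w * v := by linarith
      rcases le_or_gt (2 * v) (u * w) with hmin | hlt
      · obtain ⟨rfl, rfl, rfl⟩ := markov_minimal hu hw h₁ h₂ h' hmin
        exact .refl
      · have hpos := markov_conjugate_pos hu hv h'
        exact (ih _ (by omega) u (u * w - v) w hu hpos hw (by linarith) rfl).tail (.snd u v w)
    · have h' : v ^ 2 + w ^ 2 + u ^ 2 = v * w * u := by linarith
      rcases le_or_gt (2 * u) (v * w) with hmin | hlt
      · obtain ⟨rfl, rfl, rfl⟩ := markov_minimal hv hw h₁ h₂ h' hmin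
        exact .refl
      · have hpos := markov_conjugate_pos hv hu h'
        exact (ih _ (by omega) (v * w - u) v w hpos hv hw (by linarith) rfl).tail (.fst u v w)
end

section
/- Let R be a commutative ring, let n, m be natural numbers, let S and T be n×(2m) matrices over R, and let J be the (2m)×(2m) block matrix [[0, I_m],[I_m, 0]]. Assume S·J = T and T·J = S, set A = S·Tᵀ, assume S·Sᵀ = T·Tᵀ, and define Q = S·Sᵀ − I_n and W₁ = Tᵀ·S − J. Then for every z ∈ R, (1 − z²)^n · det(I_{2m} − z·W₁) = (1 − z²)^m · det(I_n − z·A + z²·Q). (This is Bass's determinant identity underlying the three-term determinant formula for the Ihara zeta function of an undirected graph: ζ(z)^{-1} = (1−z²)^{m−n} det(I − Az + Qz²).) -/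
open Matrix

/-- The `(2m) × (2m)` involution matrix `J = [[0, Iₘ], [Iₘ, 0]]` swapping each oriented
edge of an undirected graph with its inverse. -/
def edgeInvolution (R : Type*) [CommRing R] (m : ℕ) :
    Matrix (Fin m ⊕ Fin m) (Fin m ⊕ Fin m) R :=
  Matrix.fromBlocks 0 1 1 0

theorem edgeInvolution_mul_self (R : Type*) [CommRing R] (m : ℕ) :
    edgeInvolution R m * edgeInvolution R m = 1 := by
  simp [edgeInvolution, fromBlocks_multiply]

theorem det_one_add_smul_edgeInvolution {R : Type*} [CommRing R] (m : ℕ) (z : R) :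
    (1 + z • edgeInvolution R m).det = (1 - z ^ 2) ^ m := by
  have h : 1 + z • edgeInvolution R m =
      fromBlocks 1 (z • (1 : Matrix (Fin m) (Fin m) R)) (z • 1) 1 := by
    rw [← fromBlocks_one, edgeInvolution, fromBlocks_smul, fromBlocks_add]
    simp
  have h' : (1 : Matrix (Fin m) (Fin m) R) - (z • 1) * (z • 1) = (1 - z ^ 2) • 1 := by
    simp [sub_smul, smul_smul, sq]
  rw [h, det_fromBlocks_one₁₁, h', det_smul, det_one, Fintype.card_fin, mul_one]

/-- A Schur complement identity in which the inverse of the block `D` is replaced by a matrix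
`E` with `E * D` scalar, so that no invertibility is needed. -/
theorem pow_mul_det_sub_mul_of_mul_eq_smul {R k l : Type*} [CommRing R] [Fintype k]
    [DecidableEq k] [Fintype l] [DecidableEq l] (B : Matrix k l R) (C : Matrix l k R)
    {D E : Matrix l l R} {c : R} (hED : E * D = c • 1) :
    c ^ Fintype.card k * (D - C * B).det = (c • 1 - B * E * C).det * D.det := by
  have h : fromBlocks (c • 1) (-(B * E)) 0 1 * fromBlocks 1 B C D =
      fromBlocks (c • 1 - B * E * C) 0 C D := by
    simp [fromBlocks_multiply, Matrix.mul_assoc, hED, sub_eq_add_neg]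
  simpa [det_fromBlocks_zero₂₁, det_fromBlocks_zero₁₂, det_fromBlocks_one₁₁]
    using congrArg det h

/-- Bass's determinant identity underlying the three-term determinant formula for the
Ihara zeta function of an undirected graph.  Let `S`, `T` be `n × 2m` matrices with
`S J = T`, `T J = S` and `S Sᵀ = T Tᵀ`, and set `A = S Tᵀ`, `Q = S Sᵀ - I`,
`W₁ = Tᵀ S - J`.  Then `(1 - z²)ⁿ det (I - z W₁) = (1 - z²)ᵐ det (I - z A + z² Q)`,
i.e. `ζ(z)⁻¹ = (1 - z²)^{m - n} det (I - A z + Q z²)`. -/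
theorem bass_determinant_identity {R : Type*} [CommRing R] (n m : ℕ)
    (S T : Matrix (Fin n) (Fin m ⊕ Fin m) R)
    (hSJ : S * edgeInvolution R m = T) (hTJ : T * edgeInvolution R m = S)
    (hST : S * Sᵀ = T * Tᵀ) (z : R) :
    (1 - z ^ 2) ^ n *
        ((1 : Matrix (Fin m ⊕ Fin m) (Fin m ⊕ Fin m) R) -
          z • (Tᵀ * S - edgeInvolution R m)).det =
      (1 - z ^ 2) ^ m *
        ((1 : Matrix (Fin n) (Fin n) R) - z • (S * Tᵀ) + z ^ 2 • (S * Sᵀ - 1)).det := by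
  set J := edgeInvolution R m
  have hED : (1 - z • J) * (1 + z • J) = (1 - z ^ 2) • 1 := by
    have hJ : J * J = 1 := edgeInvolution_mul_self R m
    simp only [sub_mul, mul_add, one_mul, mul_one, smul_mul_smul_comm, hJ, sub_smul, one_smul, sq]
    abel
  have hW : 1 - z • (Tᵀ * S - J) = 1 + z • J - (z • Tᵀ) * S := by
    rw [smul_sub, smul_mul]
    abel
  have hA : 1 - z • (S * Tᵀ) + z ^ 2 • (S * Sᵀ - 1) =
      (1 - z ^ 2) • 1 - S * (1 - z • J) * (z • Tᵀ) := by
    simp only [Matrix.mul_sub, Matrix.mul_one, Matrix.mul_smul, Matrix.sub_mul, smul_mul, hSJ,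
      hST, sub_smul, one_smul, smul_sub, smul_smul, sq]
    abel
  rw [hW, hA, mul_comm ((1 - z ^ 2) ^ m), ← det_one_add_smul_edgeInvolution m z,
    ← pow_mul_det_sub_mul_of_mul_eq_smul S (z • Tᵀ) hED, Fintype.card_fin]
end

section
/- Let R be a commutative ring, let n, m be natural numbers, let S and T be n×(2m) matrices over R, and let J be the (2m)×(2m) block matrix [[0, I_m],[I_m, 0]]. Assume S·J = T and T·J = S, set A = S·Tᵀ, assume S·Sᵀ = T·Tᵀ, and define Q = S·Sᵀ − I_n and W₁ = Tᵀ·S − J. Then for every z ∈ R the following (n+2m)×(n+2m) block-matrix identity holds: [[I_n, 0],[Tᵀ, I_{2m}]] · [[(1−z²)·I_n, z·S],[0, I_{2m} − z·W₁]] = [[I_n − z·A + z²·Q, z·S],[0, I_{2m} + z·J]] · [[I_n, 0],[Tᵀ − z·Sᵀ, I_{2m}]]. -/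
open Matrix

theorem transpose_edgeInvolution (R : Type*) [CommRing R] (m : ℕ) :
    (edgeInvolution R m)ᵀ = edgeInvolution R m := by
  simp [edgeInvolution, fromBlocks_transpose]

/-- The block-matrix identity behind Bass's proof of the determinant formula for the
Ihara zeta function: with `S J = T`, `T J = S`, `S Sᵀ = T Tᵀ`, `A = S Tᵀ`,
`Q = S Sᵀ - I`, `W₁ = Tᵀ S - J`, one has
`[[I, 0], [Tᵀ, I]] · [[(1 - z²) I, z S], [0, I - z W₁]]
  = [[I - z A + z² Q, z S], [0, I + z J]] · [[I, 0], [Tᵀ - z Sᵀ, I]]`. -/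
theorem bass_block_matrix_identity {R : Type*} [CommRing R] (n m : ℕ)
    (S T : Matrix (Fin n) (Fin m ⊕ Fin m) R)
    (hSJ : S * edgeInvolution R m = T) (hTJ : T * edgeInvolution R m = S)
    (hST : S * Sᵀ = T * Tᵀ) (z : R) :
    Matrix.fromBlocks (1 : Matrix (Fin n) (Fin n) R) 0 Tᵀ
        (1 : Matrix (Fin m ⊕ Fin m) (Fin m ⊕ Fin m) R) *
      Matrix.fromBlocks ((1 - z ^ 2) • (1 : Matrix (Fin n) (Fin n) R)) (z • S) 0
        ((1 : Matrix (Fin m ⊕ Fin m) (Fin m ⊕ Fin m) R) -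
          z • (Tᵀ * S - edgeInvolution R m)) =
    Matrix.fromBlocks
        ((1 : Matrix (Fin n) (Fin n) R) - z • (S * Tᵀ) + z ^ 2 • (S * Sᵀ - 1)) (z • S) 0
        ((1 : Matrix (Fin m ⊕ Fin m) (Fin m ⊕ Fin m) R) + z • edgeInvolution R m) *
      Matrix.fromBlocks (1 : Matrix (Fin n) (Fin n) R) 0 (Tᵀ - z • Sᵀ)
        (1 : Matrix (Fin m ⊕ Fin m) (Fin m ⊕ Fin m) R) := by
  have hJ := transpose_edgeInvolution R m
  have hS : edgeInvolution R m * Sᵀ = Tᵀ := by rw [← hSJ, transpose_mul, hJ]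
  have hT : edgeInvolution R m * Tᵀ = Sᵀ := by
    rw [← hJ, ← transpose_mul, hTJ]
  simp only [fromBlocks_multiply, Matrix.one_mul, Matrix.mul_one, Matrix.zero_mul,
    Matrix.mul_zero, add_zero, zero_add]
  congr 1
  · simp only [Matrix.mul_sub, Matrix.smul_mul, Matrix.mul_smul]
    module
  · simp only [Matrix.add_mul, Matrix.mul_sub, Matrix.one_mul, Matrix.mul_one,
      Matrix.smul_mul, Matrix.mul_smul, hS, hT]
    module
  · simp only [Matrix.mul_smul]
    module
end

section
/- Let a, b, c, d, e, f be integers with c ≠ 0 and c·f = a·b + d·e. Then the F₀ anomaly-cancellation Diophantine equation a² + b² + c² + d² + e² + f² + bcd + bef = ace + adf + abcf holds if and only if a²b² + a²c² + b²c² + c²d² + c²e² + d²e² + c⁴ − a²b²c² + bc³d − ac³e + ab²ce − a²bcd + 2abde − acd²e + bcde² − abc²de = 0. More precisely, for any commutative ring and cf = ab + de, one has c²·(a² + b² + c² + d² + e² + f² + bcd + bef − ace − adf − abcf) equal to the displayed 5-variable polynomial. -/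
/-- In a commutative ring with `c f = a b + d e`, multiplying the `F₀` anomaly-cancellation
equation by `c²` eliminates `f`. -/
theorem sq_mul_F0_anomaly_eq {R : Type*} [CommRing R] {a b c d e f : R}
    (h : c * f = a * b + d * e) :
    c ^ 2 * (a ^ 2 + b ^ 2 + c ^ 2 + d ^ 2 + e ^ 2 + f ^ 2 + b * c * d + b * e * f -
        (a * c * e + a * d * f + a * b * c * f)) =
      a ^ 2 * b ^ 2 + a ^ 2 * c ^ 2 + b ^ 2 * c ^ 2 + c ^ 2 * d ^ 2 + c ^ 2 * e ^ 2 +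
        d ^ 2 * e ^ 2 + c ^ 4 - a ^ 2 * b ^ 2 * c ^ 2 + b * c ^ 3 * d - a * c ^ 3 * e +
        a * b ^ 2 * c * e - a ^ 2 * b * c * d + 2 * a * b * d * e - a * c * d ^ 2 * e +
        b * c * d * e ^ 2 - a * b * c ^ 2 * d * e := by
  linear_combination
    (c * f + a * b + d * e + b * c * e - a * c * d - a * b * c ^ 2) * h

/-- Eliminating `f` via `c f = a b + d e` reduces the `F₀` anomaly-cancellation
Diophantine equation `a² + b² + c² + d² + e² + f² + bcd + bef = ace + adf + abcf` to a
5-variable Diophantine equation: in any commutative ring, when `c f = a b + d e`,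
`c²` times the difference of the two sides equals the displayed 5-variable polynomial,
and for integers with `c ≠ 0` the equation holds if and only if that polynomial
vanishes. -/
theorem F0_diophantine_reduction :
    (∀ (R : Type) [CommRing R], ∀ a b c d e f : R, c * f = a * b + d * e →
      c ^ 2 * (a ^ 2 + b ^ 2 + c ^ 2 + d ^ 2 + e ^ 2 + f ^ 2 + b * c * d + b * e * f -
          (a * c * e + a * d * f + a * b * c * f)) =
        a ^ 2 * b ^ 2 + a ^ 2 * c ^ 2 + b ^ 2 * c ^ 2 + c ^ 2 * d ^ 2 + c ^ 2 * e ^ 2 +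
          d ^ 2 * e ^ 2 + c ^ 4 - a ^ 2 * b ^ 2 * c ^ 2 + b * c ^ 3 * d - a * c ^ 3 * e +
          a * b ^ 2 * c * e - a ^ 2 * b * c * d + 2 * a * b * d * e - a * c * d ^ 2 * e +
          b * c * d * e ^ 2 - a * b * c ^ 2 * d * e) ∧
    (∀ a b c d e f : ℤ, c ≠ 0 → c * f = a * b + d * e →
      (a ^ 2 + b ^ 2 + c ^ 2 + d ^ 2 + e ^ 2 + f ^ 2 + b * c * d + b * e * f =
          a * c * e + a * d * f + a * b * c * f ↔
        a ^ 2 * b ^ 2 + a ^ 2 * c ^ 2 + b ^ 2 * c ^ 2 + c ^ 2 * d ^ 2 + c ^ 2 * e ^ 2 +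
          d ^ 2 * e ^ 2 + c ^ 4 - a ^ 2 * b ^ 2 * c ^ 2 + b * c ^ 3 * d - a * c ^ 3 * e +
          a * b ^ 2 * c * e - a ^ 2 * b * c * d + 2 * a * b * d * e - a * c * d ^ 2 * e +
          b * c * d * e ^ 2 - a * b * c ^ 2 * d * e = 0)) := by
  refine ⟨fun R _ a b c d e f h => sq_mul_F0_anomaly_eq h, fun a b c d e f hc h => ?_⟩
  rw [← sq_mul_F0_anomaly_eq h, mul_eq_zero_iff_left (pow_ne_zero 2 hc), sub_eq_zero]
end
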